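/- Every element of H_{2,n}(q) is a finite ℤ[q,q⁻¹]-linear combination of elements of the form Π₁ Π₂ ⋯ Πₙ G, where for each i ∈ {1,…,n} the factor Πᵢ is a finite product of elements of {𝒯ᵢ, τᵢ, 𝒯ᵢ⁻¹, τᵢ⁻¹}, and G is a finite product of the braiding generators g₁, …, g_{n−1}. In other words, the set Λₙ of all such products Π₁Π₂⋯ΠₙG is a spanning set of H_{2,n}(q) as a ℤ[q,q⁻¹]-module. (Theorem 2, Part B.) -/

import Mathlib

noncomputable section

namespace MixedHecke

/-- The ring `ℤ[q,q⁻¹]` of Laurent polynomials over `ℤ`. -/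
abbrev R : Type := LaurentPolynomial ℤ

/-- The variable `q`. -/
def q : R := LaurentPolynomial.T 1

/-- The inverse `q⁻¹` of the variable `q`. -/
def qinv : R := LaurentPolynomial.T (-1)

/-- Generators of the mixed braid group `B_{2,n}`:
`Sum.inl true` is `𝒯`, `Sum.inl false` is `τ`, and `Sum.inr ⟨i, _⟩` is `σ_i` for `1 ≤ i ≤ n-1`. -/
def Gen (n : ℕ) : Type := Bool ⊕ {i : ℕ // 1 ≤ i ∧ i < n}

/-- The generator `𝒯` in the free group. -/
def fT (n : ℕ) : FreeGroup (Gen n) := FreeGroup.of (Sum.inl true)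

/-- The generator `τ` in the free group. -/
def ftau (n : ℕ) : FreeGroup (Gen n) := FreeGroup.of (Sum.inl false)

/-- The generator `σ_i` in the free group (junk value `1` for `i` out of range). -/
def fs (n i : ℕ) : FreeGroup (Gen n) :=
  if h : 1 ≤ i ∧ i < n then FreeGroup.of (Sum.inr ⟨i, h⟩) else 1

/-- The defining relators of the mixed braid group `B_{2,n}`. -/
def rels (n : ℕ) : Set (FreeGroup (Gen n)) :=
  { x | (∃ k j, 1 ≤ j ∧ j + 1 < k ∧ k < n ∧
          x = fs n k * fs n j * (fs n j * fs n k)⁻¹) ∨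
        (∃ k, 1 ≤ k ∧ k + 1 < n ∧
          x = fs n k * fs n (k+1) * fs n k * (fs n (k+1) * fs n k * fs n (k+1))⁻¹) ∨
        (∃ k, 2 ≤ k ∧ k < n ∧ x = fT n * fs n k * (fs n k * fT n)⁻¹) ∨
        (∃ k, 2 ≤ k ∧ k < n ∧ x = ftau n * fs n k * (fs n k * ftau n)⁻¹) ∨
        (1 < n ∧ x = fT n * fs n 1 * fT n * fs n 1 * (fs n 1 * fT n * fs n 1 * fT n)⁻¹) ∨
        (1 < n ∧ x = ftau n * fs n 1 * ftau n * fs n 1 * (fs n 1 * ftau n * fs n 1 * ftau n)⁻¹) ∨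
        (1 < n ∧ x = ftau n * (fs n 1 * fT n * fs n 1) * ((fs n 1 * fT n * fs n 1) * ftau n)⁻¹) }

/-- The mixed braid group `B_{2,n}` on two fixed strands. -/
abbrev B (n : ℕ) : Type := PresentedGroup (rels n)

/-- The group algebra `ℤ[q,q⁻¹] B_{2,n}`. -/
abbrev GA (n : ℕ) : Type := MonoidAlgebra R (B n)

/-- The image of `σ_i` in the group algebra. -/
def gA (n i : ℕ) : GA n := MonoidAlgebra.of R (B n) (PresentedGroup.mk (rels n) (fs n i))

/-- The quadratic relations `σ_i² = (q-1)σ_i + q·1`, `i = 1, …, n-1`. -/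
inductive quadRel (n : ℕ) : GA n → GA n → Prop
  | intro (i : ℕ) (h1 : 1 ≤ i) (h2 : i < n) :
      quadRel n (gA n i * gA n i) ((q - 1) • gA n i + q • (1 : GA n))

/-- The mixed Hecke algebra `H_{2,n}(q)`: the quotient of the group algebra `ℤ[q,q⁻¹] B_{2,n}`
by the two-sided ideal generated by the quadratic relations. -/
abbrev H (n : ℕ) : Type := RingQuot (quadRel n)

/-- The canonical monoid homomorphism `B_{2,n} →* H_{2,n}(q)`. -/
def π (n : ℕ) : B n →* H n :=
  (RingQuot.mkAlgHom R (quadRel n)).toMonoidHom.comp (MonoidAlgebra.of R (B n))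

/-- The canonical map from the free group on the generators to the units of `H_{2,n}(q)`
(images of group elements are units). -/
def U (n : ℕ) : FreeGroup (Gen n) →* (H n)ˣ :=
  ((π n).comp (PresentedGroup.mk (rels n))).toHomUnits

/-- The braiding generator `g_i` as a unit of `H_{2,n}(q)`. -/
def g (n i : ℕ) : (H n)ˣ := U n (fs n i)

/-- The word for the looping element `𝒯_i` : `𝒯_1 = 𝒯` and `𝒯_{i+1} = σ_i 𝒯_i σ_i`,
i.e. `𝒯_i = σ_{i-1} ⋯ σ_1 𝒯 σ_1 ⋯ σ_{i-1}`. -/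
def wT (n : ℕ) : ℕ → FreeGroup (Gen n)
  | 0 => 1
  | 1 => fT n
  | (i+2) => fs n (i+1) * wT n (i+1) * fs n (i+1)

/-- The word for the looping element `τ_i` : `τ_1 = τ` and `τ_{i+1} = σ_i τ_i σ_i`,
i.e. `τ_i = σ_{i-1} ⋯ σ_1 τ σ_1 ⋯ σ_{i-1}`. -/
def wtau (n : ℕ) : ℕ → FreeGroup (Gen n)
  | 0 => 1
  | 1 => ftau n
  | (i+2) => fs n (i+1) * wtau n (i+1) * fs n (i+1)

/-- The looping element `𝒯_i` as a unit of `H_{2,n}(q)`. -/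
def T (n i : ℕ) : (H n)ˣ := U n (wT n i)

/-- The looping element `τ_i` as a unit of `H_{2,n}(q)`. -/
def tau (n i : ℕ) : (H n)ˣ := U n (wtau n i)

/-- The loopings of index `i` : `𝒯_i, τ_i, 𝒯_i⁻¹, τ_i⁻¹`, as units of `H_{2,n}(q)`. -/
def LoopU (n i : ℕ) : Set (H n)ˣ := {T n i, tau n i, (T n i)⁻¹, (tau n i)⁻¹}

/-- The braiding generators `g_i`, `1 ≤ i ≤ n-1`, as elements of `H_{2,n}(q)`. -/
def BraidGens (n : ℕ) : Set (H n) := {x | ∃ i, 1 ≤ i ∧ i < n ∧ x = (g n i : H n)}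

/-- The elements `g_i^{±1}` with `lo ≤ i ≤ hi - 1`, as elements of `H_{2,n}(q)`. -/
def BraidPM (n lo hi : ℕ) : Set (H n) :=
  {x | ∃ i, lo ≤ i ∧ i < hi ∧ (x = (g n i : H n) ∨ x = ((g n i)⁻¹ : (H n)ˣ))}

section Filtration

variable {S A : Type*} [CommRing S] [Ring A] [Algebra S A]

/-- The span of the products `Y X k` with `Y` a word in `L`, `X` a word in `L'` of total length at
most `m`, and `k ∈ K`. -/
def wordFiltration (L L' : Set Aˣ) (K : Submodule S A) (m : ℕ) : Submodule S A :=
  Submodule.span S {z | ∃ Y X : List Aˣ, ∃ k ∈ K, (∀ y ∈ Y, y ∈ L) ∧ (∀ x ∈ X, x ∈ L') ∧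
    Y.length + X.length ≤ m ∧ z = (Y.prod : Aˣ) * ((X.prod : Aˣ) * k)}

/-- The span of the products `p k` with `p` a word in `L` and `k ∈ K`. -/
def wordSpan (L : Set Aˣ) (K : Submodule S A) : Submodule S A :=
  Submodule.span S {z | ∃ p ∈ Submonoid.closure ((Units.val : Aˣ → A) '' L), ∃ k ∈ K, z = p * k}

variable {L L' : Set Aˣ} {K : Submodule S A} {m : ℕ}

theorem mem_of_span_mul {s : Set A} {P : Submodule S A} {c z : A}
    (h : ∀ x ∈ s, c * x ∈ P) (hz : z ∈ Submodule.span S s) : c * z ∈ P := by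
  have : Submodule.span S s ≤ P.comap (LinearMap.mulLeft S c) :=
    Submodule.span_le.2 fun x hx => h x hx
  exact this hz

theorem wordFiltration_mono {m' : ℕ} (h : m ≤ m') :
    wordFiltration L L' K m ≤ wordFiltration L L' K m' := by
  apply Submodule.span_mono
  rintro z ⟨Y, X, k, hk, hY, hX, hl, rfl⟩
  exact ⟨Y, X, k, hk, hY, hX, hl.trans h, rfl⟩

theorem prod_mul_mem_wordFiltration {X : List Aˣ} {k : A} (hk : k ∈ K) (hX : ∀ x ∈ X, x ∈ L')
    (hl : X.length ≤ m) : ((X.prod : Aˣ) : A) * k ∈ wordFiltration L L' K m :=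
  Submodule.subset_span ⟨[], X, k, hk, by simp, hX, by simpa using hl, by simp⟩

theorem left_mul_mem_wordFiltration {y : Aˣ} (hy : y ∈ L) {z : A}
    (hz : z ∈ wordFiltration L L' K m) : (y : A) * z ∈ wordFiltration L L' K (m + 1) := by
  refine mem_of_span_mul ?_ hz
  rintro _ ⟨Y, X, k, hk, hY, hX, hl, rfl⟩
  refine Submodule.subset_span ⟨y :: Y, X, k, hk, ?_, hX, ?_, by simp [mul_assoc]⟩
  · simpa using ⟨hy, hY⟩
  · simp; omega

theorem commute_mul_mem_wordFiltration {x : Aˣ} (hx : x ∈ L') (hc : ∀ y ∈ L, Commute x y) {z : A}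
    (hz : z ∈ wordFiltration L L' K m) : (x : A) * z ∈ wordFiltration L L' K (m + 1) := by
  refine mem_of_span_mul ?_ hz
  rintro _ ⟨Y, X, k, hk, hY, hX, hl, rfl⟩
  refine Submodule.subset_span ⟨Y, x :: X, k, hk, hY, ?_, ?_, ?_⟩
  · simpa using ⟨hx, hX⟩
  · simp; omega
  · have h : Commute x Y.prod := Commute.list_prod_right Y x fun y hy => hc y (hY y hy)
    have h' : (x : A) * (Y.prod : Aˣ) = (Y.prod : Aˣ) * x := by exact_mod_cast congrArg Units.val h.eq
    rw [← mul_assoc, h']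
    simp [mul_assoc]

theorem mul_mem_of_wordFiltration {c : A} {P : Submodule S A}
    (h₀ : ∀ (X : List Aˣ), ∀ k ∈ K, (∀ x ∈ X, x ∈ L') → X.length ≤ m →
      c * (((X.prod : Aˣ) : A) * k) ∈ P)
    (h₁ : ∀ j, j + 1 = m → ∀ y ∈ L, ∀ z ∈ wordFiltration L L' K j, c * ((y : A) * z) ∈ P)
    {z : A} (hz : z ∈ wordFiltration L L' K m) : c * z ∈ P := by
  refine mem_of_span_mul ?_ hz
  rintro _ ⟨Y, X, k, hk, hY, hX, hl, rfl⟩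
  cases Y with
  | nil => simpa using h₀ X k hk hX (by simpa using hl)
  | cons y Y =>
    obtain ⟨j, rfl⟩ : ∃ j, m = j + 1 := ⟨m - 1, by simp at hl; omega⟩
    have := h₁ j rfl y (hY y (by simp)) ((Y.prod : Aˣ) * ((X.prod : Aˣ) * k))
      (Submodule.subset_span ⟨Y, X, k, hk, fun z hz => hY z (by simp [hz]), hX,
        by simp at hl; omega, rfl⟩)
    simpa [mul_assoc] using this

/-- The quadratic relation of the inverse. -/
theorem inv_mul_inv_eq {q p : S} (hpq : p * q = 1) {g : Aˣ}
    (hg : (g : A) * g = (q - 1) • (g : A) + q • (1 : A)) :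
    ((g⁻¹ : Aˣ) : A) * (g⁻¹ : Aˣ) = (p - 1) • ((g⁻¹ : Aˣ) : A) + p • (1 : A) := by
  have h1 : (1 : A) = (q - 1) • ((g⁻¹ : Aˣ) : A) + q • (((g⁻¹ : Aˣ) : A) * (g⁻¹ : Aˣ)) := by
    have := congrArg (fun x => x * (((g⁻¹ : Aˣ) : A) * (g⁻¹ : Aˣ))) hg
    simpa [mul_assoc, add_mul] using this
  have h2 := congrArg (fun x => p • x) h1
  simp only [smul_add, smul_smul, hpq, one_smul, mul_sub, mul_one] at h2
  rw [h2]
  simp only [sub_smul, one_smul]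
  abel

theorem inv_eq_smul {q p : S} (hpq : p * q = 1) {g : Aˣ}
    (hg : (g : A) * g = (q - 1) • (g : A) + q • (1 : A)) :
    ((g⁻¹ : Aˣ) : A) = p • (g : A) + (p - 1) • (1 : A) := by
  have h := congrArg (fun x => (g : A) * x) (inv_mul_inv_eq hpq hg)
  simp only [mul_add, mul_smul_comm, Units.mul_inv_cancel_left, Units.mul_inv, mul_one] at h
  rw [h]
  abel

theorem mul_mul_mul_eq_conj {G : Type*} [Group G] {g a b : G} (h : Commute b (g * a * g)) :
    g * b * g * a = g * g * a * (g * b * g) * g⁻¹ * g⁻¹ := by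
  have := congrArg (fun x => g * x * g⁻¹) h.eq
  simpa [mul_assoc] using this

theorem mul_inv_mul_inv_eq {G : Type*} [Group G] {g a b : G} (h : Commute b (g * a * g)) :
    g * b * g * g⁻¹ * g⁻¹ * a⁻¹ = a⁻¹ * g⁻¹ * g⁻¹ * (g * b * g) := by
  have := congrArg (fun x => g * x * g) h.inv_right.eq
  simpa [mul_assoc] using this

theorem mul_inv_mul_conj_inv_eq {G : Type*} [Group G] {g a b : G} (h : Commute b (g * a * g))
    (ha : Commute a (g * a * g)) :
    g * b * g * a⁻¹ * (g * a * g)⁻¹ =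
      a⁻¹ * g⁻¹ * g⁻¹ * (g * b * g) * (g * a * g)⁻¹ * g * g := by
  rw [← mul_inv_mul_inv_eq h]
  have h2 := congrArg (fun x => g * x) ha.inv_inv.eq
  have h3 := congrArg (fun x => x * g) ha.inv_inv.eq
  simp only [mul_assoc, mul_inv_rev, mul_inv_cancel_left] at h2
  simp only [mul_assoc, mul_inv_rev, inv_mul_cancel, mul_one] at h3
  simp only [mul_assoc, mul_inv_rev, inv_mul_cancel, mul_inv_cancel_left, mul_one]
  rw [h2, h3]

/-- Left multiplication by `g b g` raises the degree of the word filtration by at most one,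
provided that everything else in sight behaves well in lower degrees. -/
theorem conj_mul_mem_wordFiltration {q p : S} (hpq : p * q = 1) {g a b : Aˣ}
    (hg : (g : A) * g = (q - 1) • (g : A) + q • (1 : A))
    (hba : Commute b (g * a * g)) (haa : Commute a (g * a * g)) (hbb : Commute b (g * b * g))
    (hL : ∀ y, y ∈ L ↔ y = a ∨ y = a⁻¹ ∨ y = b ∨ y = b⁻¹)
    (hL' : ∀ x, x ∈ L' ↔ x = g * a * g ∨ x = (g * a * g)⁻¹ ∨ x = g * b * g ∨ x = (g * b * g)⁻¹)
    (hgm : ∀ j ≤ m, ∀ z ∈ wordFiltration L L' K j, (g : A) * z ∈ wordFiltration L L' K j)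
    (hb : ∀ j < m, ∀ z ∈ wordFiltration L L' K j,
      ((g * b * g : Aˣ) : A) * z ∈ wordFiltration L L' K (j + 1))
    {z : A} (hz : z ∈ wordFiltration L L' K m) :
    ((g * b * g : Aˣ) : A) * z ∈ wordFiltration L L' K (m + 1) := by
  set a' := g * a * g with ha'
  set b' := g * b * g with hb'
  have hgi : ∀ j ≤ m, ∀ z ∈ wordFiltration L L' K j,
      ((g⁻¹ : Aˣ) : A) * z ∈ wordFiltration L L' K j := by
    intro j hj z hz
    rw [inv_eq_smul hpq hg, add_mul, smul_mul_assoc, smul_mul_assoc, one_mul]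
    exact add_mem (Submodule.smul_mem _ _ (hgm j hj z hz)) (Submodule.smul_mem _ _ hz)
  have hmem : ∀ y, (y = a ∨ y = a⁻¹ ∨ y = b ∨ y = b⁻¹) → ∀ {j : ℕ} {z : A},
      z ∈ wordFiltration L L' K j → (y : A) * z ∈ wordFiltration L L' K (j + 1) :=
    fun y hy _ _ hz => left_mul_mem_wordFiltration ((hL y).2 hy) hz
  have hcomm : ∀ y ∈ L, Commute a' y := by
    intro y hy
    rcases (hL y).1 hy with rfl | rfl | rfl | rfl
    · exact haa.symm
    · exact haa.symm.inv_right
    · exact hba.symm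
    · exact hba.symm.inv_right
  have ha'm : ∀ {j : ℕ} {z : A}, z ∈ wordFiltration L L' K j →
      (a' : A) * z ∈ wordFiltration L L' K (j + 1) :=
    fun hz => commute_mul_mem_wordFiltration ((hL' _).2 (by simp)) hcomm hz
  have ha'im : ∀ {j : ℕ} {z : A}, z ∈ wordFiltration L L' K j →
      ((a'⁻¹ : Aˣ) : A) * z ∈ wordFiltration L L' K (j + 1) :=
    fun hz => commute_mul_mem_wordFiltration ((hL' _).2 (by simp))
      (fun y hy => (hcomm y hy).inv_left) hz
  have hb_b : ∀ j < m, ∀ z ∈ wordFiltration L L' K j,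
      (b' : A) * ((b : A) * z) ∈ wordFiltration L L' K (j + 1 + 1) := by
    intro j hj z hz
    rw [← mul_assoc, ← Units.val_mul, ← hbb.eq, Units.val_mul, mul_assoc]
    exact hmem b (by simp) (hb j hj z hz)
  have hb_bi : ∀ j < m, ∀ z ∈ wordFiltration L L' K j,
      (b' : A) * (((b⁻¹ : Aˣ) : A) * z) ∈ wordFiltration L L' K (j + 1 + 1) := by
    intro j hj z hz
    rw [← mul_assoc, ← Units.val_mul, ← hbb.inv_left.eq, Units.val_mul, mul_assoc]
    exact hmem b⁻¹ (by simp) (hb j hj z hz)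
  have hb_a : ∀ j < m, ∀ z ∈ wordFiltration L L' K j,
      (b' : A) * ((a : A) * z) ∈ wordFiltration L L' K (j + 1 + 1) := by
    intro j hj z hz
    have e1 : (b' : A) * a = g * g * (a * b' * (g⁻¹ : Aˣ) * (g⁻¹ : Aˣ)) := by
      have : b' * a = g * g * a * b' * g⁻¹ * g⁻¹ := mul_mul_mul_eq_conj hba
      simpa only [Units.val_mul, mul_assoc] using congrArg Units.val this
    have e2 : (g : A) * (a * b' * (g⁻¹ : Aˣ) * (g⁻¹ : Aˣ)) = a' * b * (g⁻¹ : Aˣ) := by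
      have : g * (a * b' * g⁻¹ * g⁻¹) = a' * b * g⁻¹ := by simp [ha', hb', mul_assoc]
      simpa only [Units.val_mul] using congrArg Units.val this
    have e3 : (b' : A) * ((a : A) * z) = (q - 1) • ((a' : A) * (b * ((g⁻¹ : Aˣ) * z))) +
        q • ((a : A) * (b' * ((g⁻¹ : Aˣ) * ((g⁻¹ : Aˣ) * z)))) := by
      rw [← mul_assoc, e1, hg, add_mul, smul_mul_assoc, smul_mul_assoc, e2, one_mul, add_mul,
        smul_mul_assoc, smul_mul_assoc]
      simp only [mul_assoc]
    rw [e3]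
    have h1 := hgi j hj.le z hz
    exact add_mem (Submodule.smul_mem _ _ (ha'm (hmem b (by simp) h1)))
      (Submodule.smul_mem _ _ (hmem a (by simp) (hb j hj _ (hgi j hj.le _ h1))))
  have hb_ai_ai : ∀ j, j + 1 < m → ∀ z ∈ wordFiltration L L' K j,
      (b' : A) * (((a⁻¹ : Aˣ) : A) * (((a'⁻¹ : Aˣ) : A) * z)) ∈
        wordFiltration L L' K (j + 1 + 1 + 1) := by
    intro j hj z hz
    have e : b' * a⁻¹ * a'⁻¹ = a⁻¹ * g⁻¹ * g⁻¹ * b' * a'⁻¹ * g * g :=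
      mul_inv_mul_conj_inv_eq hba haa
    have h1 := hb (j + 1) hj _ (ha'im (hgm j (by omega) _ (hgm j (by omega) _ hz)))
    have h2 := hmem a⁻¹ (by simp) (hgi (j + 2) (by omega) _ (hgi (j + 2) (by omega) _ h1))
    have e' := congrArg (fun u : Aˣ => (u : A) * z) e
    simp only [Units.val_mul, mul_assoc] at e'
    rwa [e']
  have hb_a'i : ∀ j < m, ∀ z ∈ wordFiltration L L' K j,
      (b' : A) * (((a'⁻¹ : Aˣ) : A) * z) ∈ wordFiltration L L' K (j + 1 + 1) := by
    intro j hj z hz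
    rw [← mul_assoc]
    refine mul_mem_of_wordFiltration ?_ ?_ hz
    · intro X k hk hX hl
      have := prod_mul_mem_wordFiltration (L := L) (L' := L') (X := b' :: a'⁻¹ :: X)
        (m := j + 1 + 1) hk
        (by
          intro x hx
          simp only [List.mem_cons] at hx
          rcases hx with rfl | rfl | hx
          · exact (hL' _).2 (by simp)
          · exact (hL' _).2 (by simp)
          · exact hX x hx)
        (by simpa using hl)
      simpa only [List.prod_cons, Units.val_mul, mul_assoc] using this
    · rintro i rfl y hy z hz
      have e : (b' : A) * ((a'⁻¹ : Aˣ) : A) * ((y : A) * z) =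
          (b' : A) * ((y : A) * (((a'⁻¹ : Aˣ) : A) * z)) := by
        have := congrArg Units.val (hcomm y hy).inv_left.eq
        simp only [Units.val_mul] at this
        rw [mul_assoc, ← mul_assoc _ (y : A), this, mul_assoc]
      rw [e]
      rcases (hL y).1 hy with rfl | rfl | rfl | rfl
      · exact hb_a _ hj _ (ha'im hz)
      · exact hb_ai_ai _ hj _ hz
      · exact hb_b _ hj _ (ha'im hz)
      · exact hb_bi _ hj _ (ha'im hz)
  have hb_ai : ∀ j < m, ∀ z ∈ wordFiltration L L' K j,
      (b' : A) * (((a⁻¹ : Aˣ) : A) * z) ∈ wordFiltration L L' K (j + 1 + 1) := by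
    intro j hj z hz
    have e1 : (b' : A) * (g⁻¹ : Aˣ) * (g⁻¹ : Aˣ) * (a⁻¹ : Aˣ) =
        (a⁻¹ : Aˣ) * (g⁻¹ : Aˣ) * (g⁻¹ : Aˣ) * b' := by
      have : b' * g⁻¹ * g⁻¹ * a⁻¹ = a⁻¹ * g⁻¹ * g⁻¹ * b' := mul_inv_mul_inv_eq hba
      simpa only [Units.val_mul] using congrArg Units.val this
    have e2 : ((g⁻¹ : Aˣ) : A) * (a⁻¹ : Aˣ) = (a'⁻¹ : Aˣ) * g := by
      have : g⁻¹ * a⁻¹ = a'⁻¹ * g := by simp [ha', mul_assoc]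
      simpa only [Units.val_mul] using congrArg Units.val this
    have e3 : (1 : A) = (q - 1) • ((g⁻¹ : Aˣ) : A) + q • (((g⁻¹ : Aˣ) : A) * (g⁻¹ : Aˣ)) := by
      have := congrArg (fun x => x * (((g⁻¹ : Aˣ) : A) * (g⁻¹ : Aˣ))) hg
      simpa [mul_assoc, add_mul] using this
    have e4 : (b' : A) * (((a⁻¹ : Aˣ) : A) * z) =
        (q - 1) • ((b' : A) * (((a'⁻¹ : Aˣ) : A) * (g * z))) +
        q • (((a⁻¹ : Aˣ) : A) * (((g⁻¹ : Aˣ) : A) * (((g⁻¹ : Aˣ) : A) * (b' * z)))) := by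
      calc (b' : A) * (((a⁻¹ : Aˣ) : A) * z) = (b' : A) * (1 * (((a⁻¹ : Aˣ) : A) * z)) := by
            rw [one_mul]
        _ = (q - 1) • ((b' : A) * ((((g⁻¹ : Aˣ) : A) * ((a⁻¹ : Aˣ) : A)) * z)) +
            q • (((b' : A) * (g⁻¹ : Aˣ) * (g⁻¹ : Aˣ) * (a⁻¹ : Aˣ)) * z) := by
            rw [e3]
            simp only [add_mul, mul_add, smul_mul_assoc, mul_smul_comm, mul_assoc]
        _ = _ := by
            rw [e1, e2]
            simp only [mul_assoc]
    rw [e4]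
    exact add_mem (Submodule.smul_mem _ _ (hb_a'i j hj _ (hgm j hj.le _ hz)))
      (Submodule.smul_mem _ _ (hmem _ (by simp)
        (hgi _ (by omega) _ (hgi _ (by omega) _ (hb j hj z hz)))))
  refine mul_mem_of_wordFiltration ?_ ?_ hz
  · intro X k hk hX hl
    have := prod_mul_mem_wordFiltration (L := L) (L' := L') (X := b' :: X) (m := m + 1) hk
      (by
        intro x hx
        rcases List.mem_cons.1 hx with rfl | hx
        · exact (hL' _).2 (by simp)
        · exact hX x hx)
      (by simpa using hl)
    simpa only [List.prod_cons, Units.val_mul, mul_assoc] using this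
  · rintro j rfl y hy z hz
    rcases (hL y).1 hy with rfl | rfl | rfl | rfl
    · exact hb_a _ (by omega) _ hz
    · exact hb_ai _ (by omega) _ hz
    · exact hb_b _ (by omega) _ hz
    · exact hb_bi _ (by omega) _ hz

theorem wordFiltration_stable {q p : S} (hpq : p * q = 1) {g a b : Aˣ}
    (hg : (g : A) * g = (q - 1) • (g : A) + q • (1 : A))
    (hba : Commute b (g * a * g)) (haa : Commute a (g * a * g)) (hbb : Commute b (g * b * g))
    (hL : ∀ y, y ∈ L ↔ y = a ∨ y = a⁻¹ ∨ y = b ∨ y = b⁻¹)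
    (hL' : ∀ x, x ∈ L' ↔ x = g * a * g ∨ x = (g * a * g)⁻¹ ∨ x = g * b * g ∨ x = (g * b * g)⁻¹)
    (hK : ∀ k ∈ K, (g : A) * k ∈ K) (m : ℕ) :
    (∀ j ≤ m, ∀ z ∈ wordFiltration L L' K j, (g : A) * z ∈ wordFiltration L L' K j) ∧
    (∀ j < m, ∀ z ∈ wordFiltration L L' K j,
      ((g * b * g : Aˣ) : A) * z ∈ wordFiltration L L' K (j + 1)) ∧
    (∀ j < m, ∀ z ∈ wordFiltration L L' K j,
      (((g * b * g)⁻¹ : Aˣ) : A) * z ∈ wordFiltration L L' K (j + 1)) := by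
  have hqp : q * p = 1 := by rw [mul_comm, hpq]
  have ea : (g * a * g)⁻¹ = g⁻¹ * a⁻¹ * g⁻¹ := by simp [mul_assoc]
  have eb : (g * b * g)⁻¹ = g⁻¹ * b⁻¹ * g⁻¹ := by simp [mul_assoc]
  have hg1 := inv_mul_inv_eq hpq hg
  have hg' := inv_eq_smul hpq hg
  have hcomm : ∀ y ∈ L, Commute (g * a * g) y := by
    intro y hy
    rcases (hL y).1 hy with rfl | rfl | rfl | rfl
    · exact haa.symm
    · exact haa.symm.inv_right
    · exact hba.symm
    · exact hba.symm.inv_right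
  induction m with
  | zero =>
    refine ⟨?_, by simp, by simp⟩
    intro j hj z hz
    obtain rfl : j = 0 := by omega
    refine mul_mem_of_wordFiltration ?_ (by simp) hz
    intro X k hk hX hl
    obtain rfl : X = [] := List.length_eq_zero_iff.1 (by omega)
    simpa using prod_mul_mem_wordFiltration (L := L) (L' := L') (X := []) (m := 0) (hK k hk)
      (by simp) (by simp)
  | succ m ih =>
    obtain ⟨ihg, ihb, ihbi⟩ := ih
    have ihgi : ∀ j ≤ m, ∀ z ∈ wordFiltration L L' K j,
        ((g⁻¹ : Aˣ) : A) * z ∈ wordFiltration L L' K j := by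
      intro j hj z hz
      rw [hg', add_mul, smul_mul_assoc, smul_mul_assoc, one_mul]
      exact add_mem (Submodule.smul_mem _ _ (ihg j hj z hz)) (Submodule.smul_mem _ _ hz)
    have hb : ∀ j < m + 1, ∀ z ∈ wordFiltration L L' K j,
        ((g * b * g : Aˣ) : A) * z ∈ wordFiltration L L' K (j + 1) := by
      intro j hj z hz
      rcases Nat.lt_succ_iff_lt_or_eq.1 hj with h | rfl
      · exact ihb j h z hz
      · exact conj_mul_mem_wordFiltration hpq hg hba haa hbb hL hL' ihg ihb hz
    have hbi : ∀ j < m + 1, ∀ z ∈ wordFiltration L L' K j,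
        (((g * b * g)⁻¹ : Aˣ) : A) * z ∈ wordFiltration L L' K (j + 1) := by
      intro j hj z hz
      rcases Nat.lt_succ_iff_lt_or_eq.1 hj with h | rfl
      · exact ihbi j h z hz
      · rw [eb] at ihbi ⊢
        refine conj_mul_mem_wordFiltration (a := a⁻¹) hqp hg1 ?_ ?_ ?_ ?_ ?_ ihgi ihbi hz
        · rw [← ea]; exact hba.inv_inv
        · rw [← ea]; exact haa.inv_inv
        · rw [← eb]; exact hbb.inv_inv
        · intro y
          rw [hL y, inv_inv, inv_inv]
          tauto
        · intro x
          rw [hL' x, ← ea, ← eb, inv_inv, inv_inv]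
          tauto
    refine ⟨?_, hb, hbi⟩
    intro j hj z hz
    rcases Nat.le_succ_iff.1 hj with h | rfl
    · exact ihg j h z hz
    have hgg : ∀ {u : A}, (g : A) * (g * u) = (q - 1) • ((g : A) * u) + q • u := by
      intro u
      rw [← mul_assoc, hg, add_mul, smul_mul_assoc, smul_mul_assoc, one_mul]
    have pos : ∀ c : Aˣ, (∀ w ∈ wordFiltration L L' K m,
        ((g * c * g : Aˣ) : A) * w ∈ wordFiltration L L' K (m + 1)) →
        ∀ w ∈ wordFiltration L L' K m, (g : A) * (c * w) ∈ wordFiltration L L' K (m + 1) := by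
      intro c hc w hw
      have := hc _ (ihgi m le_rfl w hw)
      simpa [mul_assoc] using this
    have neg : ∀ c : Aˣ, c ∈ L → (∀ w ∈ wordFiltration L L' K m,
        ((g⁻¹ * c * g⁻¹ : Aˣ) : A) * w ∈ wordFiltration L L' K (m + 1)) →
        ∀ w ∈ wordFiltration L L' K m, (g : A) * (c * w) ∈ wordFiltration L L' K (m + 1) := by
      intro c hcL hc w hw
      have e : (g : A) * (c * w) =
          (q - 1) • ((c : A) * w) + q • (((g⁻¹ * c * g⁻¹ : Aˣ) : A) * (g * w)) := by
        have := hgg (u := ((g⁻¹ : Aˣ) : A) * (c * w))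
        simpa [mul_assoc] using this
      rw [e]
      exact add_mem (Submodule.smul_mem _ _ (left_mul_mem_wordFiltration hcL hw))
        (Submodule.smul_mem _ _ (hc _ (ihg m le_rfl w hw)))
    refine mul_mem_of_wordFiltration ?_ ?_ hz
    · intro X k hk hX hl
      cases X with
      | nil =>
        simpa using prod_mul_mem_wordFiltration (L := L) (L' := L') (X := []) (m := m + 1)
          (hK k hk) (by simp) (by simp)
      | cons x X =>
        have hX' : ∀ y ∈ X, y ∈ L' := fun y hy => hX y (by simp [hy])
        have hl' : X.length ≤ m := by simpa using hl
        have hw := prod_mul_mem_wordFiltration (L := L) (L' := L') hk hX' hl'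
        have hxw := prod_mul_mem_wordFiltration (L := L) (L' := L') hk hX hl
        rw [List.prod_cons, Units.val_mul, mul_assoc] at hxw ⊢
        have posx : ∀ c : Aˣ, c ∈ L → x = g * c * g →
            (g : A) * (x * ((X.prod : Aˣ) * k)) ∈ wordFiltration L L' K (m + 1) := by
          rintro c hc rfl
          have e : (g : A) * (((g * c * g : Aˣ) : A) * ((X.prod : Aˣ) * k)) =
              (q - 1) • (((g * c * g : Aˣ) : A) * ((X.prod : Aˣ) * k)) +
                q • ((c : A) * (g * ((X.prod : Aˣ) * k))) := by
            have := hgg (u := (c : A) * (g * ((X.prod : Aˣ) * k)))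
            simpa [mul_assoc] using this
          rw [e]
          exact add_mem (Submodule.smul_mem _ _ hxw) (Submodule.smul_mem _ _
            (left_mul_mem_wordFiltration hc (ihg m le_rfl _ hw)))
        have negx : ∀ c : Aˣ, c ∈ L → x = g⁻¹ * c * g⁻¹ →
            (g : A) * (x * ((X.prod : Aˣ) * k)) ∈ wordFiltration L L' K (m + 1) := by
          rintro c hc rfl
          have := left_mul_mem_wordFiltration hc (ihgi m le_rfl _ hw)
          simpa [mul_assoc] using this
        rcases (hL' x).1 (hX x (by simp)) with h | h | h | h
        · exact posx a ((hL _).2 (by simp)) h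
        · exact negx a⁻¹ ((hL _).2 (by simp)) (h.trans ea)
        · exact posx b ((hL _).2 (by simp)) h
        · exact negx b⁻¹ ((hL _).2 (by simp)) (h.trans eb)
    · intro i hi y hy w hw
      obtain rfl : i = m := by omega
      rcases (hL y).1 hy with rfl | rfl | rfl | rfl
      · exact pos _ (fun w hw => commute_mul_mem_wordFiltration ((hL' _).2 (by simp)) hcomm hw) w hw
      · refine neg _ hy (fun w hw => ?_) w hw
        rw [← ea]
        exact commute_mul_mem_wordFiltration ((hL' _).2 (by simp))
          (fun y hy => (hcomm y hy).inv_left) hw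
      · exact pos _ (hb i (by omega)) w hw
      · refine neg _ hy (fun w hw => ?_) w hw
        rw [← eb]
        exact hbi i (by omega) w hw

theorem mul_mem_wordSpan {u : A} (hu : u ∈ Submonoid.closure ((Units.val : Aˣ → A) '' L)) {z : A}
    (hz : z ∈ wordSpan L K) : u * z ∈ wordSpan L K := by
  refine mem_of_span_mul ?_ hz
  rintro _ ⟨v, hv, k, hk, rfl⟩
  exact Submodule.subset_span ⟨u * v, mul_mem hu hv, k, hk, (mul_assoc _ _ _).symm⟩

theorem mul_mem_wordSpan_of_commute {c : A} (hc : ∀ y ∈ L, Commute c (y : A))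
    (hK : ∀ k ∈ K, c * k ∈ K) {z : A} (hz : z ∈ wordSpan L K) : c * z ∈ wordSpan L K := by
  refine mem_of_span_mul ?_ hz
  rintro _ ⟨v, hv, k, hk, rfl⟩
  have h : Commute c v := by
    induction hv using Submonoid.closure_induction with
    | mem x hx =>
      obtain ⟨y, hy, rfl⟩ := hx
      exact hc y hy
    | one => exact Commute.one_right c
    | mul x y _ _ hx hy => exact hx.mul_right hy
  exact Submodule.subset_span ⟨v, hv, c * k, hK k hk, by rw [← mul_assoc, h.eq, mul_assoc]⟩

theorem exists_units_list_of_mem_closure {v : A}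
    (hv : v ∈ Submonoid.closure ((Units.val : Aˣ → A) '' L)) :
    ∃ X : List Aˣ, (∀ x ∈ X, x ∈ L) ∧ ((X.prod : Aˣ) : A) = v := by
  induction hv using Submonoid.closure_induction with
  | mem x hx =>
    obtain ⟨y, hy, rfl⟩ := hx
    exact ⟨[y], by simpa using hy, by simp⟩
  | one => exact ⟨[], by simp, by simp⟩
  | mul x y _ _ hx hy =>
    obtain ⟨X, hX, rfl⟩ := hx
    obtain ⟨Y, hY, rfl⟩ := hy
    refine ⟨X ++ Y, ?_, by simp⟩
    intro x hx
    rcases List.mem_append.1 hx with h | h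
    exacts [hX x h, hY x h]

theorem list_prod_mem_closure {X : List Aˣ} (hX : ∀ x ∈ X, x ∈ L) :
    ((X.prod : Aˣ) : A) ∈ Submonoid.closure ((Units.val : Aˣ → A) '' L) := by
  rw [← Units.coeHom_apply, map_list_prod]
  refine Submonoid.list_prod_mem _ ?_
  intro x hx
  obtain ⟨y, hy, rfl⟩ := List.mem_map.1 hx
  exact Submonoid.subset_closure ⟨y, hX y hy, rfl⟩

theorem wordFiltration_le_wordSpan :
    wordFiltration L L' K m ≤ wordSpan L (wordSpan L' K) := by
  refine Submodule.span_le.2 ?_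
  rintro _ ⟨Y, X, k, hk, hY, hX, -, rfl⟩
  exact Submodule.subset_span ⟨_, list_prod_mem_closure hY, _,
    Submodule.subset_span ⟨_, list_prod_mem_closure hX, k, hk, rfl⟩, rfl⟩

theorem iSup_wordFiltration :
    ⨆ m, wordFiltration L L' K m = wordSpan L (wordSpan L' K) := by
  refine le_antisymm (iSup_le fun _ => wordFiltration_le_wordSpan) (Submodule.span_le.2 ?_)
  rintro _ ⟨v, hv, w, hw, rfl⟩
  obtain ⟨Y, hY, rfl⟩ := exists_units_list_of_mem_closure hv
  refine mem_of_span_mul ?_ hw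
  rintro _ ⟨v, hv, k, hk, rfl⟩
  obtain ⟨X, hX, rfl⟩ := exists_units_list_of_mem_closure hv
  exact le_iSup (wordFiltration L L' K) (Y.length + X.length)
    (Submodule.subset_span ⟨Y, X, k, hk, hY, hX, le_rfl, rfl⟩)

/-- The span of ordered products of words in `a^{±1}, b^{±1}` and words in
`(g a g)^{±1}, (g b g)^{±1}` is stable under left multiplication by `g`. -/
theorem mul_mem_wordSpan_wordSpan {q p : S} (hpq : p * q = 1) {g a b : Aˣ}
    (hg : (g : A) * g = (q - 1) • (g : A) + q • (1 : A))
    (hba : Commute b (g * a * g)) (haa : Commute a (g * a * g)) (hbb : Commute b (g * b * g))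
    (hL : ∀ y, y ∈ L ↔ y = a ∨ y = a⁻¹ ∨ y = b ∨ y = b⁻¹)
    (hL' : ∀ x, x ∈ L' ↔ x = g * a * g ∨ x = (g * a * g)⁻¹ ∨ x = g * b * g ∨ x = (g * b * g)⁻¹)
    (hK : ∀ k ∈ K, (g : A) * k ∈ K) {z : A} (hz : z ∈ wordSpan L (wordSpan L' K)) :
    (g : A) * z ∈ wordSpan L (wordSpan L' K) := by
  rw [← iSup_wordFiltration, Submodule.mem_iSup_of_directed _
    (Monotone.directed_le fun _ _ => wordFiltration_mono)] at hz
  obtain ⟨m, hm⟩ := hz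
  exact wordFiltration_le_wordSpan
    ((wordFiltration_stable hpq hg hba haa hbb hL hL' hK m).1 m le_rfl z hm)

end Filtration

section Conjugates

variable {G : Type*} [Group G]

/-- `g_i ⋯ g_1 x g_1 ⋯ g_i`. -/
def braidConj (s : ℕ → G) (x : G) : ℕ → G
  | 0 => x
  | i + 1 => s (i + 1) * braidConj s x i * s (i + 1)

theorem commute_braidConj_of_lt {s : ℕ → G} {x : G} {n : ℕ}
    (hs : ∀ k j, 1 ≤ j → j + 1 < k → k < n → Commute (s k) (s j))
    (hx : ∀ k, 2 ≤ k → k < n → Commute x (s k)) {k i : ℕ} (hk : i + 1 < k) (hn : k < n) :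
    Commute (s k) (braidConj s x i) := by
  induction i with
  | zero => exact (hx k (by omega) hn).symm
  | succ i ih =>
    have h := hs k (i + 1) (by omega) hk hn
    exact (h.mul_right (ih (by omega))).mul_right h

theorem commute_mul_braid {h k y : G} (hb : h * k * h = k * h * k) (hy : Commute k y) :
    Commute h (k * (h * y * h) * k) := by
  have e1 : h * (k * (h * y * h) * k) = h * k * h * y * (h * k) := by simp only [mul_assoc]
  have e2 : k * (h * y * h) * k * h = k * h * y * (h * k * h) := by simp only [mul_assoc]
  rw [Commute, SemiconjBy, e1, e2, hb]
  calc k * h * k * y * (h * k) = k * h * (k * y) * (h * k) := by simp only [mul_assoc]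
    _ = k * h * y * (k * h * k) := by rw [hy.eq]; simp only [mul_assoc]

theorem commute_braidConj_of_gt {s : ℕ → G} {x : G} {n : ℕ}
    (hs : ∀ k j, 1 ≤ j → j + 1 < k → k < n → Commute (s k) (s j))
    (hbr : ∀ k, 1 ≤ k → k + 1 < n → s k * s (k + 1) * s k = s (k + 1) * s k * s (k + 1))
    (hx : ∀ k, 2 ≤ k → k < n → Commute x (s k)) {k i : ℕ} (h1 : 1 ≤ k) (hk : k < i) (hn : i < n) :
    Commute (s k) (braidConj s x i) := by
  induction i with
  | zero => omega
  | succ i ih =>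
    rcases Nat.lt_succ_iff_lt_or_eq.1 hk with h | rfl
    · have h' := (hs (i + 1) k h1 (by omega) hn).symm
      exact (h'.mul_right (ih h (by omega))).mul_right h'
    · obtain ⟨j, rfl⟩ : ∃ j, k = j + 1 := ⟨k - 1, by omega⟩
      exact commute_mul_braid (hbr (j + 1) h1 hn)
        (commute_braidConj_of_lt hs hx (by omega) hn)

theorem commute_conj_conj {h k x y : G} (hb : h * k * h = k * h * k) (hx : Commute k x)
    (hy : Commute k y) (hxy : Commute x (h * y * h)) :
    Commute (h * x * h) (k * (h * y * h) * k) := by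
  rw [Commute, SemiconjBy]
  calc h * x * h * (k * (h * y * h) * k) = h * x * (h * k * h) * y * h * k := by
        simp only [mul_assoc]
    _ = h * (x * k) * h * (k * y) * h * k := by rw [hb]; simp only [mul_assoc]
    _ = h * k * (x * (h * y * (k * h * k))) := by rw [← hx.eq, hy.eq]; simp only [mul_assoc]
    _ = h * k * (x * (h * y * h) * k * h) := by rw [← hb]; simp only [mul_assoc]
    _ = h * k * h * y * h * (x * k) * h := by rw [hxy.eq]; simp only [mul_assoc]
    _ = k * h * (k * y) * h * k * x * h := by rw [hb, ← hx.eq]; simp only [mul_assoc]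
    _ = k * h * y * (k * h * k) * x * h := by rw [hy.eq]; simp only [mul_assoc]
    _ = k * (h * y * h) * k * (h * x * h) := by rw [← hb]; simp only [mul_assoc]

theorem commute_braidConj_succ {s : ℕ → G} {x y : G} {n : ℕ}
    (hs : ∀ k j, 1 ≤ j → j + 1 < k → k < n → Commute (s k) (s j))
    (hbr : ∀ k, 1 ≤ k → k + 1 < n → s k * s (k + 1) * s k = s (k + 1) * s k * s (k + 1))
    (hx : ∀ k, 2 ≤ k → k < n → Commute x (s k)) (hy : ∀ k, 2 ≤ k → k < n → Commute y (s k))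
    (hxy : 1 < n → Commute x (s 1 * y * s 1)) {i : ℕ} (hi : i + 1 < n) :
    Commute (braidConj s x i) (braidConj s y (i + 1)) := by
  induction i with
  | zero => exact hxy hi
  | succ i ih =>
    exact commute_conj_conj (hbr (i + 1) (by omega) hi)
      (commute_braidConj_of_lt hs hx (by omega) hi) (commute_braidConj_of_lt hs hy (by omega) hi)
      (ih (by omega))

end Conjugates

section Relations

variable {n : ℕ}

theorem U_eq_of_mem_rels {x y : FreeGroup (Gen n)} (h : x * y⁻¹ ∈ rels n) : U n x = U n y := by
  have h1 : PresentedGroup.mk (rels n) x = PresentedGroup.mk (rels n) y := by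
    rw [← mul_inv_eq_one, ← map_inv, ← map_mul]
    exact PresentedGroup.one_of_mem h
  ext
  exact congrArg (π n) h1

theorem g_commute (k j : ℕ) (h1 : 1 ≤ j) (h2 : j + 1 < k) (h3 : k < n) :
    Commute (g n k) (g n j) := by
  have := U_eq_of_mem_rels (n := n) (Or.inl ⟨k, j, h1, h2, h3, rfl⟩)
  simp only [map_mul] at this
  exact this

theorem g_braid (k : ℕ) (h1 : 1 ≤ k) (h2 : k + 1 < n) :
    g n k * g n (k + 1) * g n k = g n (k + 1) * g n k * g n (k + 1) := by
  have := U_eq_of_mem_rels (n := n) (Or.inr (Or.inl ⟨k, h1, h2, rfl⟩))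
  simp only [map_mul] at this
  exact this

theorem T_one_commute (k : ℕ) (h1 : 2 ≤ k) (h2 : k < n) : Commute (T n 1) (g n k) := by
  have := U_eq_of_mem_rels (n := n) (Or.inr (Or.inr (Or.inl ⟨k, h1, h2, rfl⟩)))
  simp only [map_mul] at this
  exact this

theorem tau_one_commute (k : ℕ) (h1 : 2 ≤ k) (h2 : k < n) : Commute (tau n 1) (g n k) := by
  have := U_eq_of_mem_rels (n := n) (Or.inr (Or.inr (Or.inr (Or.inl ⟨k, h1, h2, rfl⟩))))
  simp only [map_mul] at this
  exact this

theorem T_one_commute_conj (h : 1 < n) : Commute (T n 1) (g n 1 * T n 1 * g n 1) := by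
  have := U_eq_of_mem_rels (n := n) (Or.inr (Or.inr (Or.inr (Or.inr (Or.inl ⟨h, rfl⟩)))))
  simp only [map_mul, mul_assoc] at this
  rw [Commute, SemiconjBy]
  simp only [mul_assoc]
  exact this

theorem tau_one_commute_conj (h : 1 < n) : Commute (tau n 1) (g n 1 * tau n 1 * g n 1) := by
  have := U_eq_of_mem_rels (n := n) (Or.inr (Or.inr (Or.inr (Or.inr (Or.inr (Or.inl ⟨h, rfl⟩))))))
  simp only [map_mul, mul_assoc] at this
  rw [Commute, SemiconjBy]
  simp only [mul_assoc]
  exact this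

theorem tau_one_commute_conj_T (h : 1 < n) : Commute (tau n 1) (g n 1 * T n 1 * g n 1) := by
  have := U_eq_of_mem_rels (n := n) (Or.inr (Or.inr (Or.inr (Or.inr (Or.inr (Or.inr ⟨h, rfl⟩))))))
  simp only [map_mul] at this
  exact this

theorem T_succ_eq (i : ℕ) : T n (i + 1) = braidConj (g n) (T n 1) i := by
  induction i with
  | zero => rfl
  | succ i ih => rw [braidConj, ← ih]; simp only [T, g, wT, map_mul]

theorem tau_succ_eq (i : ℕ) : tau n (i + 1) = braidConj (g n) (tau n 1) i := by
  induction i with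
  | zero => rfl
  | succ i ih => rw [braidConj, ← ih]; simp only [tau, g, wtau, map_mul]

theorem g_mul_self {i : ℕ} (h1 : 1 ≤ i) (h2 : i < n) :
    (g n i : H n) * g n i = (q - 1) • (g n i : H n) + q • (1 : H n) := by
  have h := RingQuot.mkAlgHom_rel R (quadRel.intro i h1 h2)
  rw [map_mul, map_add, map_smul, map_smul, map_one] at h
  exact h

theorem qinv_mul_q : qinv * q = 1 := by
  rw [qinv, q, ← LaurentPolynomial.T_add]
  simp

theorem g_commute_loop {i j : ℕ} (hi : 1 ≤ i) (hi' : i < n) (hj : 1 ≤ j) (hj' : j ≤ n)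
    (h1 : j ≠ i) (h2 : j ≠ i + 1) {y : (H n)ˣ} (hy : y ∈ LoopU n j) : Commute (g n i) y := by
  obtain ⟨j, rfl⟩ : ∃ k, j = k + 1 := ⟨j - 1, by omega⟩
  have key : ∀ x : (H n)ˣ, (∀ k, 2 ≤ k → k < n → Commute x (g n k)) →
      Commute (g n i) (braidConj (g n) x j) := by
    intro x hx
    rcases lt_or_gt_of_ne h1 with h | h
    · exact commute_braidConj_of_lt g_commute hx h hi'
    · exact commute_braidConj_of_gt g_commute g_braid hx hi (by omega) (by omega)
  have hT := key _ T_one_commute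
  have htau := key _ tau_one_commute
  rw [← T_succ_eq] at hT
  rw [← tau_succ_eq] at htau
  rcases hy with rfl | rfl | rfl | rfl
  exacts [hT, htau, hT.inv_right, htau.inv_right]

/-- The span of the products `Π_j ⋯ Π_{j+k-1} G`. -/
def loopSpan (n : ℕ) : ℕ → ℕ → Submodule R (H n)
  | 0, _ => Submodule.span R (Submonoid.closure (BraidGens n) : Set (H n))
  | k + 1, j => wordSpan (S := R) (A := H n) (LoopU n j) (loopSpan n k (j + 1))

theorem g_mul_mem_loopSpan {i : ℕ} (hi : 1 ≤ i) (hi' : i < n) (k j : ℕ) (hj : 1 ≤ j)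
    (hjk : j + k = n + 1) (hji : j ≠ i + 1) {z : H n} (hz : z ∈ loopSpan n k j) :
    (g n i : H n) * z ∈ loopSpan n k j := by
  induction k using Nat.strong_induction_on generalizing j z with
  | _ k ih =>
    match k, ih with
    | 0, _ =>
      rw [loopSpan] at hz ⊢
      refine mem_of_span_mul (S := R) (A := H n) ?_ hz
      intro x hx
      exact Submodule.subset_span (mul_mem (Submonoid.subset_closure ⟨i, hi, hi', rfl⟩) hx)
    | k + 1, ih =>
      by_cases h : j = i
      · subst h
        obtain ⟨k, rfl⟩ : ∃ l, k = l + 1 := ⟨k - 1, by omega⟩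
        obtain ⟨j, rfl⟩ : ∃ l, j = l + 1 := ⟨j - 1, by omega⟩
        have eT : T n (j + 1 + 1) = g n (j + 1) * T n (j + 1) * g n (j + 1) := by
          rw [T_succ_eq, braidConj, ← T_succ_eq]
        have etau : tau n (j + 1 + 1) = g n (j + 1) * tau n (j + 1) * g n (j + 1) := by
          rw [tau_succ_eq, braidConj, ← tau_succ_eq]
        refine mul_mem_wordSpan_wordSpan (a := T n (j + 1)) (b := tau n (j + 1)) qinv_mul_q
          (g_mul_self hi hi') ?_ ?_ ?_ ?_ ?_ ?_ hz
        · rw [← eT, tau_succ_eq, T_succ_eq]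
          exact commute_braidConj_succ g_commute g_braid tau_one_commute T_one_commute
            tau_one_commute_conj_T hi'
        · rw [← eT, T_succ_eq j, T_succ_eq (j + 1)]
          exact commute_braidConj_succ g_commute g_braid T_one_commute T_one_commute
            T_one_commute_conj hi'
        · rw [← etau, tau_succ_eq j, tau_succ_eq (j + 1)]
          exact commute_braidConj_succ g_commute g_braid tau_one_commute tau_one_commute
            tau_one_commute_conj hi'
        · intro y
          simp only [LoopU, Set.mem_insert_iff, Set.mem_singleton_iff]
          tauto
        · intro y
          rw [← eT, ← etau]
          simp only [LoopU, Set.mem_insert_iff, Set.mem_singleton_iff]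
          tauto
        · intro x hx
          exact ih k (by omega) _ (by omega) (by omega) (by omega) hx
      · refine mul_mem_wordSpan_of_commute ?_ ?_ hz
        · intro y hy
          exact congrArg Units.val (g_commute_loop hi hi' hj (by omega) h hji hy).eq
        · intro x hx
          exact ih k (by omega) (j + 1) (by omega) (by omega) (by omega) hx

theorem U_mul_mem_loopSpan (hn : 1 ≤ n) (w : FreeGroup (Gen n)) {z : H n}
    (hz : z ∈ loopSpan n n 1) : (U n w : H n) * z ∈ loopSpan n n 1 := by
  have hloop : ∀ y ∈ LoopU n 1, ∀ {z : H n}, z ∈ loopSpan n n 1 →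
      (y : H n) * z ∈ loopSpan n n 1 := by
    intro y hy z hz
    obtain ⟨m, rfl⟩ : ∃ m, n = m + 1 := ⟨n - 1, by omega⟩
    exact mul_mem_wordSpan (Submonoid.subset_closure ⟨y, hy, rfl⟩) hz
  have hgs : ∀ i : {i : ℕ // 1 ≤ i ∧ i < n},
      U n (FreeGroup.of (Sum.inr i)) = g n i := by
    rintro ⟨i, hi⟩
    rw [g, fs, dif_pos hi]
  induction w using FreeGroup.induction_on generalizing z with
  | C1 => simpa using hz
  | of x =>
    rcases x with (_ | _) | i
    · exact hloop (tau n 1) (by simp [LoopU]) hz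
    · exact hloop (T n 1) (by simp [LoopU]) hz
    · rw [hgs i]
      exact g_mul_mem_loopSpan i.2.1 i.2.2 _ _ le_rfl (by omega) (by have := i.2.1; omega) hz
  | inv_of x _ =>
    rcases x with (_ | _) | i
    · exact hloop (tau n 1)⁻¹ (by simp [LoopU]) hz
    · exact hloop (T n 1)⁻¹ (by simp [LoopU]) hz
    · rw [map_inv, hgs i, inv_eq_smul (S := R) (A := H n) qinv_mul_q (g_mul_self i.2.1 i.2.2), add_mul,
        smul_mul_assoc, smul_mul_assoc, one_mul]
      exact add_mem (Submodule.smul_mem _ _ (g_mul_mem_loopSpan i.2.1 i.2.2 _ _ le_rfl (by omega)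
        (by have := i.2.1; omega) hz)) (Submodule.smul_mem _ _ hz)
  | mul x y hx hy =>
    rw [map_mul, Units.val_mul, mul_assoc]
    exact hx (hy hz)

theorem one_mem_loopSpan (k j : ℕ) : (1 : H n) ∈ loopSpan n k j := by
  induction k generalizing j with
  | zero => exact Submodule.subset_span (one_mem (Submonoid.closure (BraidGens n)))
  | succ k ih => exact Submodule.subset_span ⟨1, one_mem _, 1, ih _, (mul_one 1).symm⟩

theorem loopSpan_eq_top (hn : 1 ≤ n) : loopSpan n n 1 = ⊤ := by
  rw [eq_top_iff]
  rintro x -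
  obtain ⟨x, rfl⟩ := RingQuot.mkAlgHom_surjective R (quadRel n) x
  induction x using MonoidAlgebra.induction_on with
  | of b =>
    obtain ⟨w, rfl⟩ := PresentedGroup.mk_surjective (rels n) b
    have h := U_mul_mem_loopSpan hn w (one_mem_loopSpan n 1)
    rw [mul_one] at h
    exact h
  | add x y hx hy => rw [map_add]; exact add_mem hx hy
  | smul r x hx => rw [map_smul]; exact Submodule.smul_mem _ _ hx

theorem loopSpan_le (k j : ℕ) :
    loopSpan n k j ≤ Submodule.span R
      {x : H n | ∃ (P : ℕ → H n) (G : H n),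
        (∀ i, j ≤ i → i < j + k →
          P i ∈ Submonoid.closure ((Units.val : (H n)ˣ → H n) '' LoopU n i)) ∧
        G ∈ Submonoid.closure (BraidGens n) ∧
        x = ((List.range k).map (fun i => P (j + i))).prod * G} := by
  induction k generalizing j with
  | zero =>
    refine Submodule.span_mono ?_
    intro x hx
    exact ⟨1, x, by intros; omega, hx, by simp⟩
  | succ k ih =>
    refine Submodule.span_le.2 ?_
    rintro _ ⟨v, hv, w, hw, rfl⟩
    refine mem_of_span_mul (S := R) (A := H n) ?_ (ih (j + 1) hw)
    rintro _ ⟨P, G, hP, hG, rfl⟩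
    refine Submodule.subset_span ⟨fun i => if i = j then v else P i, G, ?_, hG, ?_⟩
    · intro i hi hi'
      dsimp only
      split_ifs with h
      · subst h
        exact hv
      · exact hP i (by omega) (by omega)
    · rw [List.range_succ_eq_map, List.map_cons, List.prod_cons, List.map_map, mul_assoc]
      congr 3
      · simp
      · refine List.map_congr_left fun i _ => ?_
        have : j + (i + 1) ≠ j := by omega
        simp only [Function.comp, Nat.succ_eq_add_one, this, if_false]
        congr 1
        omega

end Relations

/-- **Theorem 2, Part B.** The set `Λ_n` of products `Π₁ Π₂ ⋯ Π_n G`, where each `Π_i` is a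
finite product of the loopings `𝒯_i, τ_i, 𝒯_i⁻¹, τ_i⁻¹` and `G` is a finite product of the
braiding generators `g_1, …, g_{n-1}`, spans `H_{2,n}(q)` as a `ℤ[q,q⁻¹]`-module. -/
theorem lambda_spans (n : ℕ) (hn : 1 ≤ n) :
    Submodule.span R
      {x : H n | ∃ (P : ℕ → H n) (G : H n),
        (∀ i, 1 ≤ i → i ≤ n →
          P i ∈ Submonoid.closure ((Units.val : (H n)ˣ → H n) '' LoopU n i)) ∧
        G ∈ Submonoid.closure (BraidGens n) ∧
        x = ((List.range n).map (fun i => P (i + 1))).prod * G} = ⊤ := by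
  rw [eq_top_iff, ← loopSpan_eq_top hn]
  refine (loopSpan_le n 1).trans (Submodule.span_mono ?_)
  rintro _ ⟨P, G, hP, hG, rfl⟩
  exact ⟨P, G, fun i h h' => hP i h (by omega), hG, by simp only [add_comm 1]⟩

end MixedHecke
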